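/- arXiv:1006.3782 — 8 statements merged into one kernel-verified Lean document; each statement's English description precedes it below -/
import Mathlib

section
/- Let N ≥ 2 be an integer, p_c = 1/N, p_d ∈ (p_c, 1], L, M ≥ 1 natural numbers, and P_f, P_m ∈ [0,1]. Define U_rr = ((1-p_c)^(N-1)/(L+M)) · (p_c·L + p_c·(1-P_f)·M + ((1-P_f)^((N-1)/N) · (1-(1-P_f)^(1/N)))·M), U_dr = p_d·(1-p_c)^(N-1)·(L + P_m·M)/(L+M), g = (1-P_f)^((N-1)/N) − (1-p_c)·(1-P_f) − p_d·P_m, and M_min = (p_d − p_c)·L / g. Then U_rr ≥ U_dr if and only if g > 0 and M ≥ M_min. -/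
/-- Necessary and sufficient condition for a review strategy with private
signals to be deviation-proof against the constant deviation strategy with probability `pd`. -/
theorem stmt0 (N : ℕ) (hN : 2 ≤ N) (pd : ℝ)
    (hpd1 : 1 / (N : ℝ) < pd) (hpd2 : pd ≤ 1)
    (L M : ℕ) (hL : 1 ≤ L) (hM : 1 ≤ M)
    (Pf Pm : ℝ) (hPf : Pf ∈ Set.Icc (0 : ℝ) 1) (hPm : Pm ∈ Set.Icc (0 : ℝ) 1)
    (pc Urr Udr g Mmin : ℝ)
    (hpc : pc = 1 / N)
    (hUrr : Urr = ((1 - pc) ^ (N - 1) / ((L : ℝ) + M)) *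
      (pc * L + pc * (1 - Pf) * M +
        ((1 - Pf) ^ (((N : ℝ) - 1) / N) * (1 - (1 - Pf) ^ ((1 : ℝ) / N))) * M))
    (hUdr : Udr = pd * (1 - pc) ^ (N - 1) * ((L : ℝ) + Pm * M) / ((L : ℝ) + M))
    (hg : g = (1 - Pf) ^ (((N : ℝ) - 1) / N) - (1 - pc) * (1 - Pf) - pd * Pm)
    (hMmin : Mmin = (pd - pc) * L / g) :
    Urr ≥ Udr ↔ (0 < g ∧ (M : ℝ) ≥ Mmin) := by
  have hN0 : (2 : ℝ) ≤ N := by exact_mod_cast hN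
  have hL0 : (1 : ℝ) ≤ L := by exact_mod_cast hL
  have hM0 : (1 : ℝ) ≤ M := by exact_mod_cast hM
  have hq : (0 : ℝ) ≤ 1 - Pf := by linarith [hPf.2]
  have hprod : (1 - Pf) ^ (((N : ℝ) - 1) / N) * (1 - Pf) ^ ((1 : ℝ) / N) = 1 - Pf := by
    rw [← Real.rpow_add_of_nonneg hq (div_nonneg (by linarith) (by linarith)) (by positivity)]
    have : ((N : ℝ) - 1) / N + 1 / N = 1 := by
      field_simp
      ring
    rw [this, Real.rpow_one]
  have hpc1 : pc < 1 := by
    rw [hpc, div_lt_one (by linarith)]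
    linarith
  have hd : 0 < pd - pc := by
    rw [hpc]
    linarith
  have hC : 0 < (1 - pc) ^ (N - 1) / ((L : ℝ) + M) :=
    div_pos (pow_pos (by linarith) _) (by linarith)
  have hdiff : Urr - Udr = (1 - pc) ^ (N - 1) / ((L : ℝ) + M) * (g * M - (pd - pc) * L) := by
    rw [hUrr, hUdr, hg, mul_sub ((1 - Pf) ^ (((N : ℝ) - 1) / N)), hprod]
    ring
  have hdL : 0 < (pd - pc) * L := mul_pos hd (by linarith)
  have h1 : Urr ≥ Udr ↔ (pd - pc) * L ≤ g * M := by
    rw [ge_iff_le, ← sub_nonneg, hdiff, mul_nonneg_iff_of_pos_left hC, sub_nonneg]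
  rw [h1, hMmin]
  constructor
  · intro h
    have hgp : 0 < g := pos_of_mul_pos_left (lt_of_lt_of_le hdL h) (by linarith)
    refine ⟨hgp, ?_⟩
    rw [ge_iff_le, div_le_iff₀ hgp]
    linarith
  · rintro ⟨hgp, h⟩
    rw [ge_iff_le, div_le_iff₀ hgp] at h
    linarith
end

section
/- Let N ≥ 2 be an integer, p_c = 1/N, L, M ≥ 1 natural numbers, and P_f ∈ [0,1]. Define U_rr = ((1-p_c)^(N-1)/(L+M)) · (p_c·L + p_c·(1-P_f)·M + ((1-P_f)^((N-1)/N) · (1-(1-P_f)^(1/N)))·M) and the efficiency loss C = N·p_c·(1-p_c)^(N-1) − N·U_rr. Then C ≥ 0, with equality if and only if P_f = 0. -/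
theorem aux_lt (x : ℝ) (h0 : 0 ≤ x) (h1 : x < 1) (n : ℕ) :
    ((n : ℝ) + 2) * x ^ (n + 1) < 1 + ((n : ℝ) + 1) * x ^ (n + 2) := by
  induction n with
  | zero => norm_num; nlinarith [mul_pos (sub_pos.2 h1) (sub_pos.2 h1)]
  | succ n ih =>
    have h2 : x ^ (n + 2) < 1 := pow_lt_one₀ h0 h1 (by omega)
    have h3 := mul_pos (sub_pos.2 h1) (sub_pos.2 h2)
    have h4 := mul_le_mul_of_nonneg_left ih.le h0
    push_cast
    have e1 : x ^ (n + 1 + 1) = x * x ^ (n + 1) := by ring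
    have e2 : x ^ (n + 1 + 2) = x * x ^ (n + 2) := by ring
    have e3 : x ^ (n + 2) = x * x ^ (n + 1) := by ring
    rw [e1, e2]
    rw [e3] at h3 h4 ⊢
    generalize x ^ (n + 1) = y at h3 h4 ⊢
    nlinarith


/-- The efficiency loss of a review protocol with private signals is
nonnegative, and it is zero exactly when the false punishment probability is zero. -/
theorem stmt2 (N : ℕ) (hN : 2 ≤ N) (L M : ℕ) (hL : 1 ≤ L) (hM : 1 ≤ M)
    (Pf : ℝ) (hPf : Pf ∈ Set.Icc (0 : ℝ) 1)
    (pc Urr C : ℝ) (hpc : pc = 1 / N)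
    (hUrr : Urr = ((1 - pc) ^ (N - 1) / ((L : ℝ) + M)) *
      (pc * L + pc * (1 - Pf) * M +
        ((1 - Pf) ^ (((N : ℝ) - 1) / N) * (1 - (1 - Pf) ^ ((1 : ℝ) / N))) * M))
    (hC : C = N * pc * (1 - pc) ^ (N - 1) - N * Urr) :
    0 ≤ C ∧ (C = 0 ↔ Pf = 0) := by
  obtain ⟨n, rfl⟩ : ∃ n, N = n + 2 := ⟨N - 2, by omega⟩
  obtain ⟨hp0, hp1⟩ := hPf
  set x : ℝ := (1 - Pf) ^ ((1 : ℝ) / ((n + 2 : ℕ) : ℝ)) with hx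
  have hn : (((n + 2 : ℕ) : ℝ)) ≠ 0 := by positivity
  have hq : 0 ≤ 1 - Pf := by linarith
  have hx0 : 0 ≤ x := Real.rpow_nonneg hq _
  have hxN : x ^ (n + 2) = 1 - Pf := by
    rw [hx, one_div]; exact Real.rpow_inv_natCast_pow hq (by omega)
  have hxN1 : (1 - Pf) ^ ((((n + 2 : ℕ) : ℝ) - 1) / ((n + 2 : ℕ) : ℝ)) = x ^ (n + 1) := by
    rw [hx, ← Real.rpow_natCast, ← Real.rpow_mul hq]
    congr 1
    push_cast
    ring
  rw [hxN1] at hUrr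
  have hLM : (0 : ℝ) < (L : ℝ) + M := by
    have : (1 : ℝ) ≤ L := by exact_mod_cast hL
    positivity
  have hM0 : (0 : ℝ) < M := by exact_mod_cast hM
  have hpc1 : 0 < 1 - pc := by
    rw [hpc, sub_pos, div_lt_one (by positivity)]
    push_cast
    linarith [(Nat.cast_nonneg n : (0 : ℝ) ≤ n)]
  have hk : 0 < (1 - pc) ^ (n + 2 - 1) * M / ((L : ℝ) + M) := by positivity
  have hCe : C = ((1 - pc) ^ (n + 2 - 1) * M / ((L : ℝ) + M)) *
      (1 + ((n : ℝ) + 1) * x ^ (n + 2) - ((n : ℝ) + 2) * x ^ (n + 1)) := by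
    have hnp : ((n + 2 : ℕ) : ℝ) * pc = 1 := by rw [hpc]; field_simp
    rw [hC, hUrr, ← hxN]
    generalize (1 - pc) ^ (n + 2 - 1) = K
    have e3 : x ^ (n + 2) = x * x ^ (n + 1) := by ring
    rw [e3]
    generalize x ^ (n + 1) = y
    push_cast at hnp ⊢
    field_simp
    linear_combination (K * M - K * M * x * y) * hnp
  by_cases hP : Pf = 0
  · have hx1 : x = 1 := by rw [hx, hP]; simp
    have : C = 0 := by rw [hCe, hx1]; simp; right; ring
    simp [this, hP]
  · have hx1 : x < 1 := Real.rpow_lt_one hq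
      (by have := lt_of_le_of_ne hp0 (Ne.symm hP); linarith) (by positivity)
    have hpos : 0 < C := by
      rw [hCe]; exact mul_pos hk (by linarith [aux_lt x hx0 hx1 n])
    exact ⟨hpos.le, fun h => absurd h hpos.ne', fun h => absurd h hP⟩
end

section
/- Let N ≥ 2 be an integer, p_c = 1/N, and p_d ∈ (p_c, 1]. Let P_f, P_m : ℕ → [0,1] satisfy lim_{L→∞} P_f(L) = 0 and lim_{L→∞} P_m(L) = 0. For L, M ≥ 1 define U_rr(L,M) = ((1-p_c)^(N-1)/(L+M)) · (p_c·L + p_c·(1-P_f(L))·M + ((1-P_f(L))^((N-1)/N) · (1-(1-P_f(L))^(1/N)))·M), U_dr(L,M) = p_d·(1-p_c)^(N-1)·(L + P_m(L)·M)/(L+M), and C(L,M) = N·p_c·(1-p_c)^(N-1) − N·U_rr(L,M). Then for every δ > 0 there exist natural numbers L, M ≥ 1 such that U_rr(L,M) ≥ U_dr(L,M) and C(L,M) ≤ δ. -/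
/-- With an asymptotically perfect test, for every `δ > 0` there is a
review protocol that is deviation-proof against the constant deviation `pd` and `δ`-Pareto
optimal. -/
theorem stmt3 (N : ℕ) (hN : 2 ≤ N) (pd : ℝ)
    (hpd1 : 1 / (N : ℝ) < pd) (hpd2 : pd ≤ 1)
    (Pf Pm : ℕ → ℝ)
    (hPf01 : ∀ L, Pf L ∈ Set.Icc (0 : ℝ) 1) (hPm01 : ∀ L, Pm L ∈ Set.Icc (0 : ℝ) 1)
    (hPf : Filter.Tendsto Pf Filter.atTop (nhds 0))
    (hPm : Filter.Tendsto Pm Filter.atTop (nhds 0))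
    (pc : ℝ) (hpc : pc = 1 / N)
    (Urr Udr C : ℕ → ℕ → ℝ)
    (hUrr : ∀ L M, Urr L M = ((1 - pc) ^ (N - 1) / ((L : ℝ) + M)) *
      (pc * L + pc * (1 - Pf L) * M +
        ((1 - Pf L) ^ (((N : ℝ) - 1) / N) * (1 - (1 - Pf L) ^ ((1 : ℝ) / N))) * M))
    (hUdr : ∀ L M, Udr L M =
      pd * (1 - pc) ^ (N - 1) * ((L : ℝ) + Pm L * M) / ((L : ℝ) + M))
    (hC : ∀ L M, C L M = N * pc * (1 - pc) ^ (N - 1) - N * Urr L M) :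
    ∀ δ : ℝ, 0 < δ →
      ∃ L M : ℕ, 1 ≤ L ∧ 1 ≤ M ∧ Urr L M ≥ Udr L M ∧ C L M ≤ δ := by
  intro δ hδ
  have hN0 : (0 : ℝ) < N := by
    have : 0 < N := by omega
    exact_mod_cast this
  have hN2 : (2 : ℝ) ≤ N := by exact_mod_cast hN
  have hpc0 : 0 < pc := by rw [hpc]; positivity
  have hNpc : (N : ℝ) * pc = 1 := by rw [hpc]; field_simp
  have hpc1 : pc ≤ 1 := by nlinarith
  have h1 := hPf.eventually (gt_mem_nhds (show (0 : ℝ) < 1 / 4 by norm_num))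
  have h2 := hPf.eventually (gt_mem_nhds hδ)
  have h3 := hPm.eventually (gt_mem_nhds (show (0 : ℝ) < pc / 4 by positivity))
  obtain ⟨L, ⟨⟨h1, h2⟩, h3⟩, h4⟩ :=
    (((h1.and h2).and h3).and (Filter.eventually_ge_atTop 1)).exists
  have hL : (1 : ℝ) ≤ L := by exact_mod_cast h4
  obtain ⟨f0, f1⟩ := hPf01 L
  obtain ⟨m0, m1⟩ := hPm01 L
  have hX : 0 ≤ (1 - Pf L) ^ (((N : ℝ) - 1) / N) * (1 - (1 - Pf L) ^ ((1 : ℝ) / N)) := by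
    apply mul_nonneg (Real.rpow_nonneg (by linarith) _)
    have := Real.rpow_le_one (x := 1 - Pf L) (z := (1 : ℝ) / N) (by linarith) (by linarith)
      (by positivity)
    linarith
  have hA0 : 0 ≤ (1 - pc) ^ (N - 1) := pow_nonneg (by linarith) _
  have hA1 : (1 - pc) ^ (N - 1) ≤ 1 := pow_le_one₀ (by linarith) (by linarith)
  refine ⟨L, 2 * N * L, h4, ?_, ?_, ?_⟩
  · have : 0 < 2 * N * L := by positivity
    omega
  · rw [hUrr, hUdr]
    generalize (1 - Pf L) ^ (((N : ℝ) - 1) / N) * (1 - (1 - Pf L) ^ ((1 : ℝ) / N)) = X at *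
    generalize (1 - pc) ^ (N - 1) = A at *
    push_cast
    have hM : (0 : ℝ) < 2 * N * L := by positivity
    have hML : pc * (2 * N * L : ℝ) = 2 * L := by linear_combination 2 * (L : ℝ) * hNpc
    generalize (2 * N * L : ℝ) = M at *
    have key : pd * (L + Pm L * M) ≤ pc * L + pc * (1 - Pf L) * M + X * M := by
      have e1 : pc * (1 - Pf L) * M = 2 * L * (1 - Pf L) := by linear_combination (1 - Pf L) * hML
      have e2 : Pm L * M ≤ L / 2 := by nlinarith
      have e3 : 0 ≤ X * M := by positivity
      have e4 : pd * (L + Pm L * M) ≤ L + Pm L * M := by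
        have : 0 ≤ L + Pm L * M := by positivity
        nlinarith
      have e5 : 0 ≤ pc * L := by positivity
      nlinarith
    rw [ge_iff_le, div_mul_eq_mul_div]
    apply div_le_div_of_nonneg_right _ (by positivity)
    nlinarith
  · rw [hC, hUrr]
    generalize (1 - Pf L) ^ (((N : ℝ) - 1) / N) * (1 - (1 - Pf L) ^ ((1 : ℝ) / N)) = X at *
    generalize (1 - pc) ^ (N - 1) = A at *
    have hM : (0 : ℝ) < (2 * N * L : ℕ) := by
      have : 0 < 2 * N * L := by positivity
      exact_mod_cast this
    generalize ((2 * N * L : ℕ) : ℝ) = M at *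
    have hS : 0 < (L : ℝ) + M := by positivity
    have key : pc * (1 - Pf L) ≤ (pc * L + pc * (1 - Pf L) * M + X * M) / (L + M) := by
      rw [le_div_iff₀ hS]
      have : 0 ≤ X * M := by positivity
      have : 0 ≤ pc * Pf L * L := by positivity
      nlinarith
    rw [div_mul_eq_mul_div, mul_div_assoc]
    generalize (pc * L + pc * (1 - Pf L) * M + X * M) / (L + M) = Q at *
    have k2 : N * A * (pc * (1 - Pf L)) ≤ N * A * Q :=
      mul_le_mul_of_nonneg_left key (by positivity)
    have k3 : N * A * (pc * (1 - Pf L)) = A * (1 - Pf L) := by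
      linear_combination A * (1 - Pf L) * hNpc
    have k4 : A * Pf L ≤ Pf L := by nlinarith
    rw [hNpc]
    linarith
end

section
/- Let N ≥ 2 be an integer, p_c = 1/N, p_d ∈ (p_c, 1], q_c = p_c·(1-p_c)^(N-1), and q_d = p_c·(1-p_c)^(N-2)·(1-p_d). Define P_f(B,L) = 1 − (1 − F(L·(q_c−B); L, q_c))^N and P_m(B,L;p_d) = (1 − F(L·(q_c−B); L, q_d))^(N-1), where F(y;n,p) = Σ_{m=0}^{⌊y⌋} C(n,m)·p^m·(1-p)^(n-m). Then: (i) for every B ∈ (0, q_c), lim_{L→∞} P_f(B,L) = 0; (ii) for every B ∈ (0, q_c − q_d), lim_{L→∞} P_m(B,L;p_d) = 0; (iii) for every B ∈ (q_c − q_d, q_c), lim_{L→∞} P_m(B,L;p_d) = 1. -/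
/-- Binomial cumulative distribution function `F(y; n, p) = ∑_{m=0}^{⌊y⌋} C(n,m) p^m (1-p)^(n-m)`. -/
noncomputable def binCDF (y : ℝ) (n : ℕ) (p : ℝ) : ℝ :=
  ∑ m ∈ Finset.range (n + 1),
    if (m : ℝ) ≤ y then (n.choose m : ℝ) * p ^ m * (1 - p) ^ (n - m) else 0

/-- Binomial weight. -/
noncomputable def binW (n : ℕ) (p : ℝ) (m : ℕ) : ℝ :=
  (n.choose m : ℝ) * p ^ m * (1 - p) ^ (n - m)

lemma binW_nonneg (n : ℕ) {p : ℝ} (h0 : 0 ≤ p) (h1 : p ≤ 1) (m : ℕ) : 0 ≤ binW n p m := by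
  have : 0 ≤ 1 - p := by linarith
  unfold binW
  positivity

lemma binW_sum (n : ℕ) (p : ℝ) : ∑ m ∈ Finset.range (n + 1), binW n p m = 1 := by
  have h := add_pow p (1 - p) n
  rw [add_sub_cancel, one_pow] at h
  rw [h]
  refine Finset.sum_congr rfl fun m _ => ?_
  unfold binW
  ring

lemma binW_var (n : ℕ) (p : ℝ) :
    ∑ m ∈ Finset.range (n + 1), (n * p - m) ^ 2 * binW n p m = n * p * (1 - p) := by
  have h := congrArg (Polynomial.eval p) (bernsteinPolynomial.variance ℝ n)
  simp only [Polynomial.eval_finsetSum, bernsteinPolynomial, Polynomial.eval_mul,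
    Polynomial.eval_pow, Polynomial.eval_sub, Polynomial.eval_X,
    Polynomial.eval_one, Polynomial.eval_natCast, nsmul_eq_mul] at h
  simpa [binW] using h

lemma binW_cheb (n : ℕ) {p d : ℝ} (h0 : 0 ≤ p) (h1 : p ≤ 1) (hd : 0 < d) (hn : 0 < n)
    (P : ℕ → Prop) [DecidablePred P] (hP : ∀ m, P m → (n * d) ^ 2 ≤ (n * p - m) ^ 2) :
    ∑ m ∈ Finset.range (n + 1), (if P m then binW n p m else 0) ≤ p * (1 - p) / d ^ 2 / n := by
  have hn' : (0 : ℝ) < n := by exact_mod_cast hn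
  have key : (n * d) ^ 2 * ∑ m ∈ Finset.range (n + 1), (if P m then binW n p m else 0)
      ≤ n * p * (1 - p) := by
    rw [← binW_var, Finset.mul_sum]
    refine Finset.sum_le_sum fun m _ => ?_
    have hw := binW_nonneg n h0 h1 m
    split_ifs with h
    · exact mul_le_mul_of_nonneg_right (hP m h) hw
    · rw [mul_zero]; positivity
  have e : p * (1 - p) / d ^ 2 / n = n * p * (1 - p) / (n * d) ^ 2 := by
    field_simp
  rw [e, le_div_iff₀ (by positivity)]
  linarith

lemma binCDF_low {p t : ℝ} (h0 : 0 ≤ p) (h1 : p ≤ 1) (ht : t < p) :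
    Filter.Tendsto (fun L : ℕ => binCDF ((L : ℝ) * t) L p) Filter.atTop (nhds 0) := by
  refine squeeze_zero' (Filter.Eventually.of_forall fun L => ?_) ?_
    (tendsto_const_div_atTop_nhds_zero_nat (p * (1 - p) / (p - t) ^ 2))
  · refine Finset.sum_nonneg fun m _ => ?_
    have := binW_nonneg L h0 h1 m
    split_ifs
    · exact this
    · exact le_rfl
  · filter_upwards [Filter.eventually_gt_atTop 0] with L hL
    refine binW_cheb L h0 h1 (sub_pos.2 ht) hL (fun m => (m : ℝ) ≤ L * t) fun m hm => ?_
    have : (0 : ℝ) < L := by exact_mod_cast hL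
    have h2 : 0 ≤ (L : ℝ) * (p - t) := mul_nonneg this.le (by linarith)
    refine pow_le_pow_left₀ h2 ?_ 2
    linarith

lemma binCDF_high {p t : ℝ} (h0 : 0 ≤ p) (h1 : p ≤ 1) (ht : p < t) :
    Filter.Tendsto (fun L : ℕ => 1 - binCDF ((L : ℝ) * t) L p) Filter.atTop (nhds 0) := by
  have e : ∀ L : ℕ, 1 - binCDF ((L : ℝ) * t) L p =
      ∑ m ∈ Finset.range (L + 1), (if ¬ (m : ℝ) ≤ L * t then binW L p m else 0) := by
    intro L
    rw [← binW_sum L p, binCDF, ← Finset.sum_sub_distrib]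
    refine Finset.sum_congr rfl fun m _ => ?_
    by_cases h : (m : ℝ) ≤ L * t
    · simp [h, binW]
    · simp [h]
  simp only [e]
  refine squeeze_zero' (Filter.Eventually.of_forall fun L => ?_) ?_
    (tendsto_const_div_atTop_nhds_zero_nat (p * (1 - p) / (t - p) ^ 2))
  · refine Finset.sum_nonneg fun m _ => ?_
    have := binW_nonneg L h0 h1 m
    split_ifs
    · exact le_rfl
    · exact this
  · filter_upwards [Filter.eventually_gt_atTop 0] with L hL
    refine binW_cheb L h0 h1 (sub_pos.2 ht) hL (fun m => ¬ (m : ℝ) ≤ L * t) fun m hm => ?_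
    have : (0 : ℝ) < L := by exact_mod_cast hL
    have h2 : 0 ≤ (L : ℝ) * (t - p) := mul_nonneg this.le (by linarith)
    rw [← neg_sq ((L : ℝ) * p - m)]
    refine pow_le_pow_left₀ h2 ?_ 2
    have := not_le.1 hm
    linarith

/-- Asymptotic behavior of the two error probabilities of the ACK ratio test
as the review-phase length grows. -/
theorem stmt5 (N : ℕ) (hN : 2 ≤ N) (pd : ℝ)
    (hpd1 : 1 / (N : ℝ) < pd) (hpd2 : pd ≤ 1)
    (pc qc qd : ℝ) (hpc : pc = 1 / N)
    (hqc : qc = pc * (1 - pc) ^ (N - 1))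
    (hqd : qd = pc * (1 - pc) ^ (N - 2) * (1 - pd))
    (Pf Pm : ℝ → ℕ → ℝ)
    (hPf : ∀ B L, Pf B L = 1 - (1 - binCDF ((L : ℝ) * (qc - B)) L qc) ^ N)
    (hPm : ∀ B L, Pm B L = (1 - binCDF ((L : ℝ) * (qc - B)) L qd) ^ (N - 1)) :
    (∀ B ∈ Set.Ioo (0 : ℝ) qc,
      Filter.Tendsto (fun L : ℕ => Pf B L) Filter.atTop (nhds 0)) ∧
    (∀ B ∈ Set.Ioo (0 : ℝ) (qc - qd),
      Filter.Tendsto (fun L : ℕ => Pm B L) Filter.atTop (nhds 0)) ∧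
    (∀ B ∈ Set.Ioo (qc - qd) qc,
      Filter.Tendsto (fun L : ℕ => Pm B L) Filter.atTop (nhds 1)) := by
  have hN' : (2 : ℝ) ≤ N := by exact_mod_cast hN
  have hpc0 : 0 ≤ pc := by rw [hpc]; positivity
  have hpc1 : pc ≤ 1 := by rw [hpc, div_le_one (by linarith)]; linarith
  have h1pc : 0 ≤ 1 - pc := by linarith
  have h1pc' : 1 - pc ≤ 1 := by linarith
  have hqc0 : 0 ≤ qc := by rw [hqc]; positivity
  have hqc1 : qc ≤ 1 := by
    rw [hqc]
    exact mul_le_one₀ hpc1 (by positivity) (pow_le_one₀ h1pc h1pc')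
  have hpd0 : 0 ≤ 1 - pd := by linarith
  have hqd0 : 0 ≤ qd := by rw [hqd]; positivity
  have hqd1 : qd ≤ 1 := by
    rw [hqd]
    refine mul_le_one₀ (mul_le_one₀ hpc1 (by positivity) (pow_le_one₀ h1pc h1pc')) hpd0 ?_
    linarith
  refine ⟨fun B hB => ?_, fun B hB => ?_, fun B hB => ?_⟩
  · simp only [hPf]
    have h := binCDF_low hqc0 hqc1 (t := qc - B) (by linarith [hB.1])
    simpa using ((h.const_sub 1).pow N).const_sub 1
  · simp only [hPm]
    have h := binCDF_high hqd0 hqd1 (t := qc - B) (by linarith [hB.2])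
    have h2 := h.pow (N - 1)
    rwa [zero_pow (by omega)] at h2
  · simp only [hPm]
    have h := binCDF_low hqd0 hqd1 (t := qc - B) (by linarith [hB.1])
    simpa using (h.const_sub 1).pow (N - 1)
end

section
/- Let N ≥ 2 be an integer, p_c = 1/N, p_d ∈ (p_c, 1], q_c = p_c·(1-p_c)^(N-1), q_d = p_c·(1-p_c)^(N-2)·(1-p_d), and suppose B ∈ (0, q_c − q_d). With P_f(B,L) = 1 − (1 − F(L·(q_c−B); L, q_c))^N and P_m(B,L;p_d) = (1 − F(L·(q_c−B); L, q_d))^(N-1), where F(y;n,p) = Σ_{m=0}^{⌊y⌋} C(n,m)·p^m·(1-p)^(n-m), define for L, M ≥ 1: U_rr = ((1-p_c)^(N-1)/(L+M)) · (p_c·L + p_c·(1-P_f(B,L))·M + ((1-P_f(B,L))^((N-1)/N) · (1-(1-P_f(B,L))^(1/N)))·M), U_dr = p_d·(1-p_c)^(N-1)·(L + P_m(B,L;p_d)·M)/(L+M), and C = N·p_c·(1-p_c)^(N-1) − N·U_rr. Then for every δ > 0 there exist natural numbers L, M ≥ 1 such that U_rr ≥ U_dr and C ≤ δ. -/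
lemma binTerm_nonneg (n m : ℕ) (p : ℝ) (h0 : 0 ≤ p) (h1 : p ≤ 1) :
    0 ≤ (n.choose m : ℝ) * p ^ m * (1 - p) ^ (n - m) := by
  have : 0 ≤ 1 - p := by linarith
  positivity

lemma binTerm_sum (n : ℕ) (p : ℝ) :
    ∑ m ∈ Finset.range (n + 1), (n.choose m : ℝ) * p ^ m * (1 - p) ^ (n - m) = 1 := by
  have h := congrArg (Polynomial.eval p) (bernsteinPolynomial.sum ℝ n)
  simpa [Polynomial.eval_finsetSum, bernsteinPolynomial] using h

lemma binTerm_var (n : ℕ) (p : ℝ) :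
    ∑ m ∈ Finset.range (n + 1),
      (n * p - m) ^ 2 * ((n.choose m : ℝ) * p ^ m * (1 - p) ^ (n - m)) = n * p * (1 - p) := by
  have h := congrArg (Polynomial.eval p) (bernsteinPolynomial.variance ℝ n)
  simpa [Polynomial.eval_finsetSum, bernsteinPolynomial] using h

lemma binCDF_nonneg (y : ℝ) (n : ℕ) (p : ℝ) (h0 : 0 ≤ p) (h1 : p ≤ 1) : 0 ≤ binCDF y n p := by
  unfold binCDF
  refine Finset.sum_nonneg fun m _ => ?_
  split_ifs
  · exact binTerm_nonneg n m p h0 h1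
  · exact le_rfl

lemma one_sub_binCDF (y : ℝ) (n : ℕ) (p : ℝ) :
    1 - binCDF y n p = ∑ m ∈ Finset.range (n + 1),
      if (m : ℝ) ≤ y then 0 else (n.choose m : ℝ) * p ^ m * (1 - p) ^ (n - m) := by
  refine (congrArg (fun x => x - binCDF y n p) (binTerm_sum n p).symm).trans ?_
  simp only [binCDF]
  rw [← Finset.sum_sub_distrib]
  refine Finset.sum_congr rfl fun m _ => ?_
  split_ifs <;> simp

lemma binCDF_le_one (y : ℝ) (n : ℕ) (p : ℝ) (h0 : 0 ≤ p) (h1 : p ≤ 1) : binCDF y n p ≤ 1 := by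
  rw [← sub_nonneg, one_sub_binCDF]
  refine Finset.sum_nonneg fun m _ => ?_
  split_ifs
  · exact le_rfl
  · exact binTerm_nonneg n m p h0 h1

lemma cheb_aux (n : ℕ) (hn : 1 ≤ n) (p t S : ℝ) (h0 : 0 ≤ p) (h1 : p ≤ 1) (ht : 0 < t)
    (h : (n * t) ^ 2 * S ≤ n * p * (1 - p)) : S ≤ 1 / t ^ 2 * (1 / n) := by
  have hn' : (0 : ℝ) < n := by exact_mod_cast hn
  have h2 : (n * t) ^ 2 * S ≤ n := by
    have : p * (1 - p) ≤ 1 := by nlinarith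
    nlinarith
  rw [div_mul_div_comm, le_div_iff₀ (by positivity)]
  have : n * (S * (n * t ^ 2)) ≤ n * 1 := by nlinarith
  nlinarith [le_of_mul_le_mul_left this hn']

lemma cheb_lower (n : ℕ) (hn : 1 ≤ n) (p t : ℝ) (h0 : 0 ≤ p) (h1 : p ≤ 1) (ht : 0 < t) :
    binCDF (n * (p - t)) n p ≤ 1 / t ^ 2 * (1 / n) := by
  refine cheb_aux n hn p t _ h0 h1 ht ?_
  rw [← binTerm_var n p, binCDF, Finset.mul_sum]
  refine Finset.sum_le_sum fun m _ => ?_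
  have hb := binTerm_nonneg n m p h0 h1
  have hnt : 0 ≤ (n : ℝ) * t := by positivity
  split_ifs with hm
  · refine mul_le_mul_of_nonneg_right ?_ hb
    exact pow_le_pow_left₀ hnt (by linarith) 2
  · rw [mul_zero]; positivity

lemma cheb_upper (n : ℕ) (hn : 1 ≤ n) (p t : ℝ) (h0 : 0 ≤ p) (h1 : p ≤ 1) (ht : 0 < t) :
    1 - binCDF (n * (p + t)) n p ≤ 1 / t ^ 2 * (1 / n) := by
  refine cheb_aux n hn p t _ h0 h1 ht ?_
  rw [← binTerm_var n p, one_sub_binCDF, Finset.mul_sum]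
  refine Finset.sum_le_sum fun m _ => ?_
  have hb := binTerm_nonneg n m p h0 h1
  have hnt : 0 ≤ (n : ℝ) * t := by positivity
  split_ifs with hm
  · rw [mul_zero]; positivity
  · refine mul_le_mul_of_nonneg_right ?_ hb
    rw [← neg_sq (n * p - m : ℝ)]
    exact pow_le_pow_left₀ hnt (by linarith) 2

open Filter Topology in
lemma cheb_rate (t : ℝ) : Tendsto (fun n : ℕ => 1 / t ^ 2 * (1 / (n : ℝ))) atTop (𝓝 0) := by
  have h := (tendsto_one_div_atTop_nhds_zero_nat (𝕜 := ℝ)).const_mul (1 / t ^ 2)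
  rwa [mul_zero] at h

open Filter Topology in
lemma lower_tendsto (p t : ℝ) (h0 : 0 ≤ p) (h1 : p ≤ 1) (ht : 0 < t) :
    Tendsto (fun n : ℕ => binCDF (n * (p - t)) n p) atTop (𝓝 0) := by
  refine tendsto_of_tendsto_of_tendsto_of_le_of_le' tendsto_const_nhds (cheb_rate t) ?_ ?_
  · exact Eventually.of_forall fun n => binCDF_nonneg _ _ _ h0 h1
  · filter_upwards [eventually_ge_atTop 1] with n hn using cheb_lower n hn p t h0 h1 ht

open Filter Topology in
lemma upper_tendsto (p t : ℝ) (h0 : 0 ≤ p) (h1 : p ≤ 1) (ht : 0 < t) :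
    Tendsto (fun n : ℕ => 1 - binCDF (n * (p + t)) n p) atTop (𝓝 0) := by
  refine tendsto_of_tendsto_of_tendsto_of_le_of_le' tendsto_const_nhds (cheb_rate t) ?_ ?_
  · exact Eventually.of_forall fun n => sub_nonneg.2 (binCDF_le_one _ _ _ h0 h1)
  · filter_upwards [eventually_ge_atTop 1] with n hn using cheb_upper n hn p t h0 h1 ht

open Filter Topology

/-- With a margin of error `B ∈ (0, q_c - q_d)`, for every `δ > 0` there are
lengths `L, M` such that the review protocol based on the ACK ratio test is deviation-proof
against the constant deviation `pd` and `δ`-Pareto optimal. -/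
theorem stmt6 (N : ℕ) (hN : 2 ≤ N) (pd : ℝ)
    (hpd1 : 1 / (N : ℝ) < pd) (hpd2 : pd ≤ 1)
    (pc qc qd : ℝ) (hpc : pc = 1 / N)
    (hqc : qc = pc * (1 - pc) ^ (N - 1))
    (hqd : qd = pc * (1 - pc) ^ (N - 2) * (1 - pd))
    (B : ℝ) (hB : B ∈ Set.Ioo (0 : ℝ) (qc - qd))
    (Pf Pm : ℕ → ℝ)
    (hPf : ∀ L, Pf L = 1 - (1 - binCDF ((L : ℝ) * (qc - B)) L qc) ^ N)
    (hPm : ∀ L, Pm L = (1 - binCDF ((L : ℝ) * (qc - B)) L qd) ^ (N - 1))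
    (Urr Udr C : ℕ → ℕ → ℝ)
    (hUrr : ∀ L M, Urr L M = ((1 - pc) ^ (N - 1) / ((L : ℝ) + M)) *
      (pc * L + pc * (1 - Pf L) * M +
        ((1 - Pf L) ^ (((N : ℝ) - 1) / N) * (1 - (1 - Pf L) ^ ((1 : ℝ) / N))) * M))
    (hUdr : ∀ L M, Udr L M =
      pd * (1 - pc) ^ (N - 1) * ((L : ℝ) + Pm L * M) / ((L : ℝ) + M))
    (hC : ∀ L M, C L M = N * pc * (1 - pc) ^ (N - 1) - N * Urr L M) :
    ∀ δ : ℝ, 0 < δ →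
      ∃ L M : ℕ, 1 ≤ L ∧ 1 ≤ M ∧ Urr L M ≥ Udr L M ∧ C L M ≤ δ := by
  intro δ hδ
  obtain ⟨hB0, hB1⟩ := hB
  have hN2 : (2 : ℝ) ≤ N := by exact_mod_cast hN
  have hN0 : (0 : ℝ) < N := by linarith
  have hpc0 : 0 < pc := by rw [hpc]; positivity
  have hNpc : (N : ℝ) * pc = 1 := by rw [hpc]; field_simp
  have hpc1 : pc < 1 := by nlinarith
  have h1pc : 0 < 1 - pc := by linarith
  have hA0 : 0 < (1 - pc) ^ (N - 1) := by positivity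
  have hA1 : (1 - pc) ^ (N - 1) ≤ 1 := pow_le_one₀ h1pc.le (by linarith)
  have hqc0 : 0 ≤ qc := by rw [hqc]; positivity
  have hqc1 : qc ≤ 1 := by rw [hqc]; nlinarith
  have hqd0 : 0 ≤ qd := by
    rw [hqd]
    have : 0 ≤ 1 - pd := by linarith
    positivity
  have hqd1 : qd ≤ 1 := by linarith
  have T1 := lower_tendsto qc B hqc0 hqc1 hB0
  have T2 := upper_tendsto qd (qc - qd - B) hqd0 hqd1 (by linarith)
  have e2 : qd + (qc - qd - B) = qc - B := by ring
  rw [e2] at T2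
  have TPf : Tendsto (fun L => 1 - Pf L) atTop (𝓝 1) := by
    have := (T1.const_sub 1).pow N
    simp only [sub_zero, one_pow] at this
    refine this.congr fun L => ?_
    rw [hPf]; ring
  have TPm : Tendsto Pm atTop (𝓝 0) := by
    have := T2.pow (N - 1)
    rw [zero_pow (by omega)] at this
    exact this.congr fun L => (hPm L).symm
  set A := (1 - pc) ^ (N - 1) with hA
  have TU : Tendsto (fun L => A * pc * (1 + N * (1 - Pf L)) / (1 + N)) atTop (𝓝 (A * pc)) := by
    have := (((TPf.const_mul (N : ℝ)).const_add 1).const_mul (A * pc)).div_const (1 + (N : ℝ))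
    convert this using 2
    field_simp
  have TD : Tendsto (fun L => pd * A * (1 + N * Pm L) / (1 + N)) atTop
      (𝓝 (pd * A / (1 + N))) := by
    have := (((TPm.const_mul (N : ℝ)).const_add 1).const_mul (pd * A)).div_const (1 + (N : ℝ))
    convert this using 2
    ring
  have hlt : pd * A / (1 + N) < A * pc := by
    rw [div_lt_iff₀ (by positivity)]
    nlinarith [mul_pos hA0 hpc0]
  have E1 := TD.eventually_lt TU hlt
  have E2 := TU.eventually_const_lt (show A * pc - δ / N < A * pc by
    have : 0 < δ / N := by positivity
    linarith)
  obtain ⟨L, hE1, hE2, hL⟩ := (E1.and (E2.and (eventually_ge_atTop 1))).exists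
  have hL0 : (0 : ℝ) < L := by exact_mod_cast hL
  have hx0 : 0 ≤ 1 - Pf L := by
    have := binCDF_le_one ((L : ℝ) * (qc - B)) L qc hqc0 hqc1
    have h : 0 ≤ 1 - binCDF ((L : ℝ) * (qc - B)) L qc := by linarith
    rw [hPf, sub_sub_cancel]; positivity
  have hx1 : 1 - Pf L ≤ 1 := by
    have := binCDF_le_one ((L : ℝ) * (qc - B)) L qc hqc0 hqc1
    have h2 := binCDF_nonneg ((L : ℝ) * (qc - B)) L qc hqc0 hqc1
    rw [hPf, sub_sub_cancel]
    exact pow_le_one₀ (by linarith) (by linarith)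
  have hr : 0 ≤ (1 - Pf L) ^ (((N : ℝ) - 1) / N) * (1 - (1 - Pf L) ^ ((1 : ℝ) / N)) := by
    refine mul_nonneg (Real.rpow_nonneg hx0 _) (sub_nonneg.2 ?_)
    exact Real.rpow_le_one hx0 hx1 (by positivity)
  have hU : A * pc * (1 + N * (1 - Pf L)) / (1 + N) ≤ Urr L (N * L) := by
    rw [hUrr]
    generalize (1 - Pf L) ^ (((N : ℝ) - 1) / N) * (1 - (1 - Pf L) ^ ((1 : ℝ) / N)) = r at hr
    have : A / ((L : ℝ) + ((N * L : ℕ) : ℝ)) * (pc * L + pc * (1 - Pf L) * ((N * L : ℕ) : ℝ)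
        + r * ((N * L : ℕ) : ℝ)) = A * pc * (1 + N * (1 - Pf L)) / (1 + N) + A * r * N / (1 + N) := by
      push_cast
      field_simp
    rw [this]
    have : 0 ≤ A * r * N / (1 + N) := by positivity
    linarith
  have hD : Udr L (N * L) = pd * A * (1 + N * Pm L) / (1 + N) := by
    rw [hUdr]
    push_cast
    field_simp
  refine ⟨L, N * L, hL, Nat.mul_pos (by omega) hL, ?_, ?_⟩
  · rw [hD]; linarith
  · rw [hC]
    have h3 : A * pc - δ / N < Urr L (N * L) := by linarith
    have h4 := mul_lt_mul_of_pos_left h3 hN0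
    have h5 : (N : ℝ) * (A * pc - δ / N) = N * pc * A - δ := by field_simp
    linarith
end

section
/- Let N ≥ 2 be an integer, p_c = 1/N, p_d ∈ (p_c, 1], L, M ≥ 1 natural numbers, and P̃_f, P̃_m ∈ [0,1]. Define Ũ_rr = L·p_c·(1-p_c)^(N-1) / (L + P̃_f·M), Ũ_dr = L·p_d·(1-p_c)^(N-1) / (L + (1−P̃_m)·M), g̃ = p_c·(1−P̃_m) − p_d·P̃_f, and M̃_min = (p_d − p_c)·L / g̃. Then Ũ_rr ≥ Ũ_dr if and only if g̃ > 0 and M ≥ M̃_min. -/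
/-- Necessary and sufficient condition for a review strategy with public
signals to be deviation-proof against the deviation strategy using `pd` in review phases. -/
theorem stmt9 (N : ℕ) (hN : 2 ≤ N) (pd : ℝ)
    (hpd1 : 1 / (N : ℝ) < pd) (hpd2 : pd ≤ 1)
    (L M : ℕ) (hL : 1 ≤ L) (hM : 1 ≤ M)
    (Pf Pm : ℝ) (hPf : Pf ∈ Set.Icc (0 : ℝ) 1) (hPm : Pm ∈ Set.Icc (0 : ℝ) 1)
    (pc Urr Udr g Mmin : ℝ)
    (hpc : pc = 1 / N)
    (hUrr : Urr = (L : ℝ) * pc * (1 - pc) ^ (N - 1) / ((L : ℝ) + Pf * M))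
    (hUdr : Udr = (L : ℝ) * pd * (1 - pc) ^ (N - 1) / ((L : ℝ) + (1 - Pm) * M))
    (hg : g = pc * (1 - Pm) - pd * Pf)
    (hMmin : Mmin = (pd - pc) * L / g) :
    Urr ≥ Udr ↔ (0 < g ∧ (M : ℝ) ≥ Mmin) := by
  have hlt : pc < pd := by rw [hpc]; exact hpd1
  have hpc1 : 0 < 1 - pc := by linarith
  have hLr : (0 : ℝ) < L := by exact_mod_cast hL
  have hMr : (0 : ℝ) < M := by exact_mod_cast hM
  have hQ : 0 < (L : ℝ) * (1 - pc) ^ (N - 1) := by positivity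
  have hA : 0 < (L : ℝ) + Pf * M := by
    have := mul_nonneg hPf.1 hMr.le
    linarith
  have hB : 0 < (L : ℝ) + (1 - Pm) * M := by
    have := mul_nonneg (sub_nonneg.2 hPm.2) hMr.le
    linarith
  have hdiff : 0 < (pd - pc) * (L : ℝ) := mul_pos (by linarith) hLr
  have key : Urr ≥ Udr ↔ (pd - pc) * L ≤ M * g := by
    rw [ge_iff_le, hUrr, hUdr, div_le_div_iff₀ hB hA]
    have e1 : (L : ℝ) * pd * (1 - pc) ^ (N - 1) * (L + Pf * M)
        = ((L : ℝ) * (1 - pc) ^ (N - 1)) * (pd * (L + Pf * M)) := by ring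
    have e2 : (L : ℝ) * pc * (1 - pc) ^ (N - 1) * (L + (1 - Pm) * M)
        = ((L : ℝ) * (1 - pc) ^ (N - 1)) * (pc * (L + (1 - Pm) * M)) := by ring
    rw [e1, e2, mul_le_mul_iff_right₀ hQ, hg]
    constructor <;> intro h <;> linarith
  rw [key]
  constructor
  · intro h
    have hg0 : 0 < g := pos_of_mul_pos_right (lt_of_lt_of_le hdiff h) hMr.le
    refine ⟨hg0, ?_⟩
    rw [hMmin, ge_iff_le, div_le_iff₀ hg0]
    exact h
  · rintro ⟨hg0, h⟩
    rwa [hMmin, ge_iff_le, div_le_iff₀ hg0] at h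
end

section
/- Let N ≥ 2 be an integer, p_c = 1/N, p_d ∈ (p_c, 1], and q_c = p_c·(1-p_c)^(N-1). Let P̃_f, P̃_m : ℕ → [0,1] satisfy lim_{L→∞} P̃_f(L) = 0 and lim_{L→∞} P̃_m(L) = 0. For L, M ≥ 1 define Ũ_rr(L,M) = L·q_c / (L + P̃_f(L)·M), Ũ_dr(L,M) = L·p_d·(1-p_c)^(N-1) / (L + (1−P̃_m(L))·M), and C̃(L,M) = N·P̃_f(L)·M·q_c / (L + P̃_f(L)·M). Then for every δ > 0 there exist natural numbers L, M ≥ 1 such that Ũ_rr(L,M) ≥ Ũ_dr(L,M) and C̃(L,M) ≤ δ. -/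
/-- With an asymptotically perfect test and public signals, for every `δ > 0`
there is a review protocol that is deviation-proof against the deviation `pd` and
`δ`-Pareto optimal. -/
theorem stmt10 (N : ℕ) (hN : 2 ≤ N) (pd : ℝ)
    (hpd1 : 1 / (N : ℝ) < pd) (hpd2 : pd ≤ 1)
    (pc qc : ℝ) (hpc : pc = 1 / N)
    (hqc : qc = pc * (1 - pc) ^ (N - 1))
    (Pf Pm : ℕ → ℝ)
    (hPf01 : ∀ L, Pf L ∈ Set.Icc (0 : ℝ) 1) (hPm01 : ∀ L, Pm L ∈ Set.Icc (0 : ℝ) 1)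
    (hPf : Filter.Tendsto Pf Filter.atTop (nhds 0))
    (hPm : Filter.Tendsto Pm Filter.atTop (nhds 0))
    (Urr Udr C : ℕ → ℕ → ℝ)
    (hUrr : ∀ L M, Urr L M = (L : ℝ) * qc / ((L : ℝ) + Pf L * M))
    (hUdr : ∀ L M, Udr L M =
      (L : ℝ) * pd * (1 - pc) ^ (N - 1) / ((L : ℝ) + (1 - Pm L) * M))
    (hC : ∀ L M, C L M = N * Pf L * M * qc / ((L : ℝ) + Pf L * M)) :
    ∀ δ : ℝ, 0 < δ →
      ∃ L M : ℕ, 1 ≤ L ∧ 1 ≤ M ∧ Urr L M ≥ Udr L M ∧ C L M ≤ δ := by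
  intro δ hδ
  have hN0 : (2 : ℝ) ≤ N := by exact_mod_cast hN
  have hNp : (0 : ℝ) < N := by linarith
  have hNpc : (N : ℝ) * pc = 1 := by rw [hpc]; field_simp
  have hpc0 : 0 < pc := by rw [hpc]; positivity
  have hpc1 : pc ≤ 1 := by nlinarith
  have hpd0 : 0 ≤ pd := by rw [← hpc] at hpd1; linarith
  have e1 := hPf.eventually_lt_const (show (0 : ℝ) < 1 / (4 * N) by positivity)
  have e2 := hPf.eventually_lt_const (show (0 : ℝ) < δ / (2 * N) by positivity)
  have e3 := hPm.eventually_lt_const (show (0 : ℝ) < 1 / 4 by norm_num)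
  obtain ⟨L, ⟨⟨h1, h2⟩, h3⟩, hL⟩ :=
    (((e1.and e2).and e3).and (Filter.eventually_ge_atTop 1)).exists
  have hf0 := (hPf01 L).1
  have hm0 := (hPm01 L).1
  have hLp : (0 : ℝ) < L := by exact_mod_cast hL
  rw [lt_div_iff₀ (by positivity)] at h1 h2
  have hs0 : 0 ≤ (1 - pc) ^ (N - 1) := pow_nonneg (by linarith) _
  have hs1 : (1 - pc) ^ (N - 1) ≤ 1 := pow_le_one₀ (by linarith) (by linarith)
  generalize (1 - pc) ^ (N - 1) = s at *
  have hA : (0 : ℝ) < 1 + Pf L * (2 * N) := by positivity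
  have hB : (0 : ℝ) < 1 + (1 - Pm L) * (2 * N) := by
    have : 0 ≤ 1 - Pm L := by linarith
    positivity
  have dA : (L : ℝ) + Pf L * ((2 * N * L : ℕ) : ℝ) = L * (1 + Pf L * (2 * N)) := by
    push_cast; ring
  have dB : (L : ℝ) + (1 - Pm L) * ((2 * N * L : ℕ) : ℝ)
      = L * (1 + (1 - Pm L) * (2 * N)) := by
    push_cast; ring
  have key : pd * (1 + Pf L * (2 * N)) ≤ pc * (1 + (1 - Pm L) * (2 * N)) := by
    have r : pc * (1 + (1 - Pm L) * (2 * N)) = pc + 2 * (1 - Pm L) := by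
      linear_combination 2 * (1 - Pm L) * hNpc
    rw [r]
    have := mul_le_mul_of_nonneg_right hpd2 hA.le
    linarith
  refine ⟨L, 2 * N * L, hL, ?_, ?_, ?_⟩
  · have : 0 < 2 * N * L := by positivity
    omega
  · rw [hUrr, hUdr, dA, dB, ge_iff_le, mul_assoc, mul_div_mul_left _ _ hLp.ne',
      mul_div_mul_left _ _ hLp.ne', div_le_div_iff₀ hB hA, hqc]
    nlinarith [mul_le_mul_of_nonneg_right key hs0]
  · have n : (N : ℝ) * Pf L * ((2 * N * L : ℕ) : ℝ) * qc = L * (Pf L * (2 * N) * s) := by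
      rw [hqc]; push_cast
      linear_combination 2 * N * L * Pf L * s * hNpc
    rw [hC, dA, n, mul_div_mul_left _ _ hLp.ne', div_le_iff₀ hA]
    have hx : 0 ≤ Pf L * (2 * N) := by positivity
    nlinarith [mul_le_mul_of_nonneg_left hs1 hx, mul_nonneg hδ.le hx]
end

section
/- Let N ≥ 2 be an integer, p_c = 1/N, q_c = p_c·(1-p_c)^(N-1), μ > N−1 a real number, and b ≥ 0. Then the function f : [0,1] → ℝ defined by f(P) = (q_c + P·(1-p_c)^N + (1−P)·b) / (1 + P·μ) is non-increasing on [0,1]; in particular, f(P) ≤ q_c + b for all P ∈ [0,1]. -/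
/-- The upper bound on an arbitrary deviator's payoff is non-increasing in the
punishment probability `P`, hence bounded by `q_c + b`. -/
theorem stmt16 (N : ℕ) (hN : 2 ≤ N) (μ b : ℝ) (hμ : (N : ℝ) - 1 < μ) (hb : 0 ≤ b)
    (pc qc : ℝ) (hpc : pc = 1 / N) (hqc : qc = pc * (1 - pc) ^ (N - 1))
    (f : ℝ → ℝ)
    (hf : ∀ P, f P = (qc + P * (1 - pc) ^ N + (1 - P) * b) / (1 + P * μ)) :
    AntitoneOn f (Set.Icc 0 1) ∧ ∀ P ∈ Set.Icc (0 : ℝ) 1, f P ≤ qc + b := by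
  have hN' : (2 : ℝ) ≤ N := by exact_mod_cast hN
  have hN0 : (0 : ℝ) < N := by linarith
  have hpc0 : 0 < pc := by rw [hpc]; positivity
  have hpN : pc * N = 1 := by rw [hpc]; field_simp
  have h1 : 1 - pc = (N - 1) * pc := by linarith
  have h1' : 0 ≤ 1 - pc := by
    rw [h1]
    exact mul_nonneg (by linarith) hpc0.le
  have hq0 : 0 ≤ qc := by rw [hqc]; positivity
  have ha : (1 - pc) ^ N = (N - 1) * qc := by
    obtain ⟨k, rfl⟩ : ∃ k, N = k + 1 := ⟨N - 1, by omega⟩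
    rw [hqc, pow_succ, Nat.add_sub_cancel]
    linear_combination (1 - pc) ^ k * h1
  have hμ0 : 0 < μ := by linarith
  have hD : (1 - pc) ^ N - b ≤ (qc + b) * μ := by
    rw [ha]
    have e1 : ((N : ℝ) - 1) * qc ≤ μ * qc := mul_le_mul_of_nonneg_right hμ.le hq0
    have e2 : 0 ≤ b * μ := by positivity
    linarith
  have hanti : AntitoneOn f (Set.Icc 0 1) := by
    intro x hx y hy hxy
    have hx0 := hx.1
    have hy0 := hy.1
    rw [hf, hf, div_le_div_iff₀ (by positivity) (by positivity)]
    have e := mul_nonneg (sub_nonneg.2 hxy) (sub_nonneg.2 hD)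
    linarith
  refine ⟨hanti, fun P hP => ?_⟩
  have h := hanti (Set.left_mem_Icc.2 zero_le_one) hP hP.1
  have h0 : f 0 = qc + b := by rw [hf]; simp
  linarith
end
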